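/- Let L₁, L be real numbers with 0 < L₁ ≤ L/2, set α := L₁/L and suppose α is irrational; define ξ_n = 2|αn − ⌊αn + 1/2⌋| for each positive integer n. If ω < 0 and u : ℝ → ℝ is a twice continuously differentiable L-periodic function with −u''(x) − u(x)³ = ω·u(x) for all x ∈ ℝ, u(0) = √(2|ω|) and u(L₁) = ε·√(2|ω|) with ε ∈ {+1, −1}, then there exist a positive integer n and k ∈ (1/√2, 1) such that S(k) = L·√(−ω)/n, u is L/n-periodic, and φ(k) = ξ_n in case ε = +1, while φ(k) = 1 − ξ_n in case ε = −1. -/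

import Mathlib

open Real Filter Set

/-- Complete elliptic integral of the first kind. -/
noncomputable def Kell (k : ℝ) : ℝ :=
  ∫ t in (0:ℝ)..1, 1 / Real.sqrt ((1 - t^2) * (1 - k^2 * t^2))

/-- S(k) = 4√(2k²−1)·K(k). -/
noncomputable def Sfun (k : ℝ) : ℝ := 4 * Real.sqrt (2 * k^2 - 1) * Kell k

/-- H(k), the numerator in the definition of φ. -/
noncomputable def Hfun (k : ℝ) : ℝ :=
  ∫ t in Real.sqrt ((2 * k^2 - 1) / k^2)..1,
    1 / Real.sqrt ((1 - t^2) * (1 - k^2 * (1 - t^2)))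

/-- φ(k) = H(k)/K(k). -/
noncomputable def phiFun (k : ℝ) : ℝ := Hfun k / Kell k

/-- ξ_n = 2|αn − ⌊αn + 1/2⌋|. -/
noncomputable def xiSeq (α : ℝ) (n : ℕ) : ℝ :=
  2 * |α * n - (⌊α * n + 1/2⌋ : ℝ)|

/-- Incomplete elliptic integral of the first kind, in trigonometric form. -/
noncomputable def ellipticF (k θ : ℝ) : ℝ :=
  ∫ t in (0:ℝ)..θ, 1 / √(1 - k ^ 2 * sin t ^ 2)

lemma one_sub_mul_sin_sq_pos {k : ℝ} (hk : k ^ 2 < 1) (θ : ℝ) :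
    0 < 1 - k ^ 2 * sin θ ^ 2 := by
  nlinarith [sin_sq_le_one θ, sq_nonneg (sin θ), sq_nonneg k]

lemma continuous_ellipticF_integrand {k : ℝ} (hk : k ^ 2 < 1) :
    Continuous fun t : ℝ => 1 / √(1 - k ^ 2 * sin t ^ 2) := by
  refine continuous_const.div (by fun_prop) fun t => ?_
  exact (sqrt_pos.2 (one_sub_mul_sin_sq_pos hk t)).ne'

lemma hasDerivAt_ellipticF {k : ℝ} (hk : k ^ 2 < 1) (θ : ℝ) :
    HasDerivAt (ellipticF k) (1 / √(1 - k ^ 2 * sin θ ^ 2)) θ :=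
  intervalIntegral.integral_hasDerivAt_right
    ((continuous_ellipticF_integrand hk).intervalIntegrable _ _)
    (continuous_ellipticF_integrand hk).stronglyMeasurable.stronglyMeasurableAtFilter
    (continuous_ellipticF_integrand hk).continuousAt

lemma strictMono_ellipticF {k : ℝ} (hk : k ^ 2 < 1) : StrictMono (ellipticF k) := by
  refine strictMono_of_deriv_pos fun θ => ?_
  rw [(hasDerivAt_ellipticF hk θ).deriv]
  exact one_div_pos.2 (sqrt_pos.2 (one_sub_mul_sin_sq_pos hk θ))

lemma ellipticF_zero (k : ℝ) : ellipticF k 0 = 0 := by simp [ellipticF]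

lemma ellipticF_neg (k θ : ℝ) : ellipticF k (-θ) = -ellipticF k θ := by
  unfold ellipticF
  have h := intervalIntegral.integral_comp_neg (a := 0) (b := θ)
    (fun t : ℝ => 1 / √(1 - k ^ 2 * sin t ^ 2))
  simp only [sin_neg, neg_sq, neg_zero] at h
  rw [h, intervalIntegral.integral_symm]

lemma ellipticF_add_pi {k : ℝ} (hk : k ^ 2 < 1) (θ : ℝ) :
    ellipticF k (θ + π) = ellipticF k θ + 2 * ellipticF k (π / 2) := by
  have hconst : ∀ x y : ℝ,
      ellipticF k (x + π) - ellipticF k x = ellipticF k (y + π) - ellipticF k y := by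
    have hd : ∀ x : ℝ, HasDerivAt (fun x => ellipticF k (x + π) - ellipticF k x) 0 x := by
      intro x
      refine (((hasDerivAt_ellipticF hk (x + π)).comp_add_const x π).sub
        (hasDerivAt_ellipticF hk x)).congr_deriv ?_
      simp [sin_add_pi]
    exact is_const_of_deriv_eq_zero (fun x => (hd x).differentiableAt) fun x => (hd x).deriv
  have h := hconst θ (-(π / 2))
  rw [ellipticF_neg, show -(π / 2) + π = π / 2 by ring] at h
  linarith

lemma ellipticF_int_mul_two_pi_add {k : ℝ} (hk : k ^ 2 < 1) (m : ℤ) (θ : ℝ) :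
    ellipticF k (m * (2 * π) + θ) = m * (4 * ellipticF k (π / 2)) + ellipticF k θ := by
  have hstep : ∀ x : ℝ, ellipticF k (x + 2 * π) = ellipticF k x + 4 * ellipticF k (π / 2) := by
    intro x
    rw [show x + 2 * π = x + π + π by ring, ellipticF_add_pi hk, ellipticF_add_pi hk]
    ring
  induction m using Int.induction_on with
  | zero => simp
  | succ i ih =>
    have h := hstep ((i : ℤ) * (2 * π) + θ)
    rw [ih] at h
    push_cast at h ⊢
    rw [show ((i : ℝ) + 1) * (2 * π) + θ = i * (2 * π) + θ + 2 * π by ring, h]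
    ring
  | pred i ih =>
    have h := hstep (((-(i : ℤ) - 1 : ℤ) : ℝ) * (2 * π) + θ)
    push_cast at h ih ⊢
    rw [show (-(i : ℝ) - 1) * (2 * π) + θ + 2 * π = -i * (2 * π) + θ by ring, ih] at h
    linarith

lemma ellipticF_pi_div_two_pos {k : ℝ} (hk : k ^ 2 < 1) : 0 < ellipticF k (π / 2) := by
  simpa [ellipticF_zero] using strictMono_ellipticF hk (by positivity : (0 : ℝ) < π / 2)

lemma surjective_ellipticF {k : ℝ} (hk : k ^ 2 < 1) : Function.Surjective (ellipticF k) := by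
  have hK := ellipticF_pi_div_two_pos hk
  intro y
  obtain ⟨N, hN⟩ := exists_nat_ge (|y| / (4 * ellipticF k (π / 2)))
  rw [div_le_iff₀ (by positivity)] at hN
  have hcont : Continuous (ellipticF k) :=
    continuous_iff_continuousAt.2 fun θ => (hasDerivAt_ellipticF hk θ).continuousAt
  have h1 := ellipticF_int_mul_two_pi_add hk N 0
  have h2 := ellipticF_int_mul_two_pi_add hk (-N) 0
  rw [ellipticF_zero] at h1 h2
  push_cast at h1 h2
  refine mem_range_of_exists_le_of_exists_ge hcont
    ⟨-(N : ℝ) * (2 * π) + 0, ?_⟩ ⟨(N : ℝ) * (2 * π) + 0, ?_⟩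
  · rw [h2]; linarith [neg_abs_le y]
  · rw [h1]; linarith [le_abs_self y]

/-- Existence of the Jacobi amplitude function, the inverse of `ellipticF k`. -/
lemma exists_jacobi_amplitude {k : ℝ} (hk : k ^ 2 < 1) :
    ∃ am : ℝ → ℝ, (∀ x, ellipticF k (am x) = x) ∧
      ∀ x, HasDerivAt am (√(1 - k ^ 2 * sin (am x) ^ 2)) x := by
  let e := (strictMono_ellipticF hk).orderIsoOfSurjective _ (surjective_ellipticF hk)
  have he : ∀ x, ellipticF k (e.symm x) = x := fun x => e.apply_symm_apply x
  refine ⟨e.symm, he, fun x => ?_⟩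
  have hpos := sqrt_pos.2 (one_sub_mul_sin_sq_pos hk (e.symm x))
  have h := HasDerivAt.of_local_left_inverse e.symm.continuous.continuousAt
    (hasDerivAt_ellipticF hk (e.symm x)) (one_div_pos.2 hpos).ne' (Eventually.of_forall he)
  simpa using h

lemma Kell_eq_ellipticF (k : ℝ) : Kell k = ellipticF k (π / 2) := by
  have himg : sin '' Ioo 0 (π / 2) = Ioo 0 1 := by
    ext y
    constructor
    · rintro ⟨x, ⟨h0, h1⟩, rfl⟩
      refine ⟨sin_pos_of_pos_of_lt_pi h0 (by linarith [pi_pos]), ?_⟩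
      have := sin_lt_sin_of_lt_of_le_pi_div_two (by linarith) le_rfl h1
      rwa [sin_pi_div_two] at this
    · rintro ⟨h0, h1⟩
      exact ⟨arcsin y, ⟨arcsin_pos.2 h0, arcsin_lt_pi_div_two.2 h1⟩,
        sin_arcsin (by linarith) h1.le⟩
  have hsub : Ioo 0 (π / 2) ⊆ Icc (-(π / 2)) (π / 2) :=
    fun x hx => ⟨by linarith [hx.1, pi_pos], hx.2.le⟩
  unfold Kell ellipticF
  rw [intervalIntegral.integral_of_le zero_le_one, intervalIntegral.integral_of_le (by positivity),
    MeasureTheory.integral_Ioc_eq_integral_Ioo, MeasureTheory.integral_Ioc_eq_integral_Ioo, ← himg,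
    MeasureTheory.integral_image_eq_integral_abs_deriv_smul measurableSet_Ioo
      (fun x _ => (hasDerivAt_sin x).hasDerivWithinAt)
      (injOn_sin.mono hsub)]
  refine MeasureTheory.setIntegral_congr_fun measurableSet_Ioo fun x hx => ?_
  have hc : 0 < cos x := cos_pos_of_mem_Ioo ⟨by linarith [hx.1, pi_pos], hx.2⟩
  have hs : 1 - sin x ^ 2 = cos x ^ 2 := by linarith [sin_sq_add_cos_sq x]
  simp only [smul_eq_mul]
  rw [hs, sqrt_mul (sq_nonneg _), sqrt_sq hc.le, abs_of_pos hc]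
  field_simp

lemma integral_cos_substitution (k : ℝ) {θ : ℝ} (h0 : 0 ≤ θ) (hπ : θ ≤ π) :
    ∫ t in cos θ..1, 1 / √((1 - t ^ 2) * (1 - k ^ 2 * (1 - t ^ 2))) = ellipticF k θ := by
  have himg : cos '' Ioo 0 θ = Ioo (cos θ) 1 := by
    ext y
    constructor
    · rintro ⟨x, ⟨hx0, hx1⟩, rfl⟩
      refine ⟨cos_lt_cos_of_nonneg_of_le_pi hx0.le hπ hx1, ?_⟩
      simpa using cos_lt_cos_of_nonneg_of_le_pi le_rfl (by linarith) hx0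
    · rintro ⟨hy0, hy1⟩
      have hy : -1 ≤ y := by linarith [neg_one_le_cos θ]
      refine ⟨arccos y, ⟨arccos_pos.2 hy1, ?_⟩, cos_arccos hy hy1.le⟩
      rw [← arccos_cos h0 hπ]
      exact strictAntiOn_arccos ⟨neg_one_le_cos θ, cos_le_one θ⟩ ⟨hy, hy1.le⟩ hy0
  have hsub : Ioo 0 θ ⊆ Icc 0 π := fun x hx => ⟨hx.1.le, hx.2.le.trans hπ⟩
  unfold ellipticF
  rw [intervalIntegral.integral_of_le (cos_le_one θ), intervalIntegral.integral_of_le h0,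
    MeasureTheory.integral_Ioc_eq_integral_Ioo, MeasureTheory.integral_Ioc_eq_integral_Ioo, ← himg,
    MeasureTheory.integral_image_eq_integral_abs_deriv_smul measurableSet_Ioo
      (fun x _ => (hasDerivAt_cos x).hasDerivWithinAt)
      (injOn_cos.mono hsub)]
  refine MeasureTheory.setIntegral_congr_fun measurableSet_Ioo fun x hx => ?_
  have hs : 0 < sin x := sin_pos_of_pos_of_lt_pi hx.1 (hx.2.trans_le hπ)
  have hc : 1 - cos x ^ 2 = sin x ^ 2 := by linarith [sin_sq_add_cos_sq x]
  simp only [smul_eq_mul]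
  rw [hc, sqrt_mul (sq_nonneg _), sqrt_sq hs.le, abs_neg, abs_of_pos hs]
  field_simp

/-- Uniqueness for linear homogeneous second order equations without first order term. -/
lemma eq_zero_of_linear_second_order {d d' q : ℝ → ℝ} (hq : Continuous q)
    (hd : ∀ x, HasDerivAt d (d' x) x) (hd' : ∀ x, HasDerivAt d' (q x * d x) x)
    (h0 : d 0 = 0) (h0' : d' 0 = 0) (x : ℝ) : d x = 0 := by
  obtain ⟨M, hM⟩ := (isCompact_Icc (a := -(|x| + 1)) (b := |x| + 1)).exists_bound_of_continuousOn
    hq.continuousOn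
  have hx : x ∈ Ioo (-(|x| + 1)) (|x| + 1) :=
    ⟨by linarith [neg_abs_le x], by linarith [le_abs_self x]⟩
  have h0mem : (0 : ℝ) ∈ Ioo (-(|x| + 1)) (|x| + 1) :=
    ⟨by linarith [abs_nonneg x], by linarith [abs_nonneg x]⟩
  have hlip : ∀ t ∈ Ioo (-(|x| + 1)) (|x| + 1),
      LipschitzOnWith (max 1 M).toNNReal (fun p : ℝ × ℝ => (p.2, q t * p.1)) univ := by
    intro t ht
    refine LipschitzOnWith.of_dist_le_mul fun p _ r _ => ?_
    rw [coe_toNNReal _ (le_max_of_le_left zero_le_one), Prod.dist_eq]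
    refine max_le ?_ ?_
    · calc dist p.2 r.2 ≤ 1 * dist p r := by rw [one_mul]; exact le_max_right _ _
        _ ≤ _ := by gcongr; exact le_max_left _ _
    · have h := hM t (Ioo_subset_Icc_self ht)
      calc dist (q t * p.1) (q t * r.1) = ‖q t‖ * dist p.1 r.1 := by
            rw [dist_eq_norm, dist_eq_norm, ← mul_sub, norm_mul]
        _ ≤ _ := mul_le_mul (h.trans (le_max_right _ _)) (le_max_left _ _) dist_nonneg
            (le_max_of_le_left zero_le_one)
  have hsol := ODE_solution_unique_of_mem_Ioo (f := fun t => (d t, d' t))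
    (g := fun _ => ((0 : ℝ), (0 : ℝ))) hlip h0mem
    (fun t _ => ⟨(hd t).prodMk (hd' t), mem_univ _⟩)
    (fun t _ => ⟨(hasDerivAt_const t ((0 : ℝ), (0 : ℝ))).congr_deriv
      (by simp only [mul_zero]; rfl), mem_univ _⟩)
    (by simp [h0, h0']) hx
  exact congrArg Prod.fst hsol

lemma duffing_unique {w : ℝ} {u u' v v' : ℝ → ℝ}
    (hu : ∀ x, HasDerivAt u (u' x) x) (hu' : ∀ x, HasDerivAt u' (w * u x - u x ^ 3) x)
    (hv : ∀ x, HasDerivAt v (v' x) x) (hv' : ∀ x, HasDerivAt v' (w * v x - v x ^ 3) x)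
    (h0 : u 0 = v 0) (h0' : u' 0 = v' 0) (x : ℝ) : u x = v x := by
  have hcu : Continuous u := continuous_iff_continuousAt.2 fun x => (hu x).continuousAt
  have hcv : Continuous v := continuous_iff_continuousAt.2 fun x => (hv x).continuousAt
  have h := eq_zero_of_linear_second_order
    (d := fun x => u x - v x) (d' := fun x => u' x - v' x)
    (q := fun x => w - (u x ^ 2 + u x * v x + v x ^ 2)) (by fun_prop)
    (fun x => (hu x).sub (hv x))
    (fun x => ((hu' x).sub (hv' x)).congr_deriv (by ring)) (by simp [h0]) (by simp [h0']) x
  exact sub_eq_zero.1 h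

lemma hasDerivAt_sech_profile (a b x : ℝ) :
    HasDerivAt (fun x => a / cosh (b * x)) (-(a * b * sinh (b * x)) / cosh (b * x) ^ 2) x := by
  have hb : HasDerivAt (fun x : ℝ => b * x) b x := by simpa using (hasDerivAt_id x).const_mul b
  have h := (hasDerivAt_const x a).div hb.cosh (cosh_pos _).ne'
  refine h.congr_deriv ?_
  ring

lemma hasDerivAt_deriv_sech_profile {a b : ℝ} (hab : a ^ 2 = 2 * b ^ 2) (x : ℝ) :
    HasDerivAt (fun x => -(a * b * sinh (b * x)) / cosh (b * x) ^ 2)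
      (b ^ 2 * (a / cosh (b * x)) - (a / cosh (b * x)) ^ 3) x := by
  have hb : HasDerivAt (fun x : ℝ => b * x) b x := by simpa using (hasDerivAt_id x).const_mul b
  have hc := (cosh_pos (b * x)).ne'
  have h := (hb.sinh.const_mul (a * b)).neg.div (hb.cosh.pow 2) (pow_ne_zero 2 hc)
  refine h.congr_deriv ?_
  have hs : sinh (b * x) ^ 2 = cosh (b * x) ^ 2 - 1 := by linarith [cosh_sq (b * x)]
  have ha : a ^ 3 = a * (2 * b ^ 2) := by rw [← hab]; ring
  simp only [Pi.pow_apply, Pi.neg_apply]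
  rw [div_pow, ha]
  push_cast
  field_simp
  linear_combination (2 * a * b ^ 2) * hs

/-- A solution with vanishing derivative at the homoclinic level is a soliton, hence aperiodic. -/
lemma not_periodic_of_homoclinic {w L : ℝ} (hw : 0 < w) (hL : 0 < L) {u u' : ℝ → ℝ}
    (hu : ∀ x, HasDerivAt u (u' x) x) (hu' : ∀ x, HasDerivAt u' (w * u x - u x ^ 3) x)
    (h0 : u 0 = √(2 * w)) (h0' : u' 0 = 0) : ¬ Function.Periodic u L := by
  intro hper
  have hb : √w ^ 2 = w := sq_sqrt hw.le
  have hsol := duffing_unique hu hu' (fun x => hasDerivAt_sech_profile (√(2 * w)) (√w) x)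
    (fun x => (hasDerivAt_deriv_sech_profile
      (by rw [sq_sqrt (by positivity), hb]) x).congr_deriv (by rw [hb]))
    (by simp [h0]) (by simp [h0']) L
  rw [hper.eq, h0] at hsol
  have ha : 0 < √(2 * w) := sqrt_pos.2 (by positivity)
  have h1 : 1 < cosh (√w * L) := one_lt_cosh.2 (mul_pos (sqrt_pos.2 hw) hL).ne'
  exact absurd hsol (div_lt_self ha h1).ne'

lemma hasDerivAt_cnoidal {k a b : ℝ} {θ : ℝ → ℝ}
    (hθ : ∀ x, HasDerivAt θ (b * √(1 - k ^ 2 * sin (θ x) ^ 2)) x) (x : ℝ) :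
    HasDerivAt (fun x => a * cos (θ x))
      (-(a * b) * (sin (θ x) * √(1 - k ^ 2 * sin (θ x) ^ 2))) x :=
  ((hθ x).cos.const_mul a).congr_deriv (by ring)

lemma hasDerivAt_deriv_cnoidal {k a b w : ℝ} (hk : k ^ 2 < 1)
    (hw : b ^ 2 * (2 * k ^ 2 - 1) = w) (ha : 2 * k ^ 2 * b ^ 2 = a ^ 2) {θ : ℝ → ℝ}
    (hθ : ∀ x, HasDerivAt θ (b * √(1 - k ^ 2 * sin (θ x) ^ 2)) x) (x : ℝ) :
    HasDerivAt (fun x => -(a * b) * (sin (θ x) * √(1 - k ^ 2 * sin (θ x) ^ 2)))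
      (w * (a * cos (θ x)) - (a * cos (θ x)) ^ 3) x := by
  have hpos := one_sub_mul_sin_sq_pos hk (θ x)
  have hD := ((((hθ x).sin.pow 2).const_mul (k ^ 2)).const_sub 1).sqrt hpos.ne'
  refine (((hθ x).sin.mul hD).const_mul (-(a * b))).congr_deriv ?_
  simp only [Pi.pow_apply]
  have hD0 := (sqrt_pos.2 hpos).ne'
  have hDsq := sq_sqrt hpos.le
  set D := √(1 - k ^ 2 * sin (θ x) ^ 2)
  have hs : sin (θ x) ^ 2 = 1 - cos (θ x) ^ 2 := by linarith [sin_sq_add_cos_sq (θ x)]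
  have key : a * b ^ 2 * cos (θ x) * (k ^ 2 * sin (θ x) ^ 2 - D ^ 2) =
      w * (a * cos (θ x)) - (a * cos (θ x)) ^ 3 := by
    rw [hDsq, hs, ← hw]
    linear_combination (-a * cos (θ x) ^ 3) * ha
  rw [← key]
  push_cast
  field_simp
  ring

lemma xiSeq_eq {α φ : ℝ} {n : ℕ} {m : ℤ} (h0 : 0 < φ) (h1 : φ < 1)
    (h : α * n = m + φ / 2 ∨ α * n = m - φ / 2) : xiSeq α n = φ := by
  have hfl : ⌊α * n + 1 / 2⌋ = m := by
    rw [Int.floor_eq_iff]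
    rcases h with h | h <;> constructor <;> linarith
  rw [xiSeq, hfl]
  rcases h with h | h
  · rw [h, add_sub_cancel_left, abs_of_pos (by linarith)]; ring
  · rw [h, show (m : ℝ) - φ / 2 - m = -(φ / 2) by ring, abs_neg, abs_of_pos (by linarith)]; ring

/-- Every solution crossing the homoclinic level `√(2w)` with nonzero slope is a cnoidal wave. -/
lemma exists_cnoidal_representation {w : ℝ} (hw : 0 < w) {u u' : ℝ → ℝ}
    (hu : ∀ x, HasDerivAt u (u' x) x) (hu' : ∀ x, HasDerivAt u' (w * u x - u x ^ 3) x)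
    (h0 : u 0 = √(2 * w)) (hp : u' 0 ≠ 0) :
    ∃ k a b s θ₀ : ℝ, ∃ θ : ℝ → ℝ, 0 < k ∧ 1 / 2 < k ^ 2 ∧ k ^ 2 < 1 ∧ 0 < a ∧ 0 < b ∧
      b ^ 2 * (2 * k ^ 2 - 1) = w ∧ 0 < θ₀ ∧ θ₀ < π / 2 ∧
      cos θ₀ = √((2 * k ^ 2 - 1) / k ^ 2) ∧ a * cos θ₀ = √(2 * w) ∧ (s = 1 ∨ s = -1) ∧
      (∀ x, ellipticF k (θ x) = b * x + s * ellipticF k θ₀) ∧ ∀ x, u x = a * cos (θ x) := by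
  set p := u' 0
  have hp2 : 0 < p ^ 2 := by positivity
  obtain ⟨R, hR, hRsq⟩ : ∃ R : ℝ, 0 < R ∧ R ^ 2 = w ^ 2 + 2 * p ^ 2 :=
    ⟨√(w ^ 2 + 2 * p ^ 2), sqrt_pos.2 (by positivity), sq_sqrt (by positivity)⟩
  have hRw : w < R := by nlinarith
  have hA : 0 < w + R := by linarith
  obtain ⟨k, hk, hksq⟩ : ∃ k : ℝ, 0 < k ∧ k ^ 2 = (w + R) / (2 * R) :=
    ⟨√((w + R) / (2 * R)), sqrt_pos.2 (by positivity), sq_sqrt (by positivity)⟩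
  obtain ⟨b, hb, hbsq⟩ : ∃ b : ℝ, 0 < b ∧ b ^ 2 = R := ⟨√R, sqrt_pos.2 hR, sq_sqrt hR.le⟩
  obtain ⟨a, ha, hasq⟩ : ∃ a : ℝ, 0 < a ∧ a ^ 2 = w + R := ⟨√(w + R), sqrt_pos.2 hA, sq_sqrt hA.le⟩
  have hk1 : 1 / 2 < k ^ 2 := by rw [hksq, lt_div_iff₀ (by positivity)]; linarith
  have hk2 : k ^ 2 < 1 := by rw [hksq, div_lt_one (by positivity)]; linarith
  have hbw : b ^ 2 * (2 * k ^ 2 - 1) = w := by rw [hbsq, hksq]; field_simp; ring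
  have hba : 2 * k ^ 2 * b ^ 2 = a ^ 2 := by rw [hbsq, hksq, hasq]; field_simp
  have hratio : (2 * k ^ 2 - 1) / k ^ 2 = 2 * w / (w + R) := by
    rw [hksq]; field_simp; ring
  have hr0 : 0 < 2 * w / (w + R) := by positivity
  have hr1 : 2 * w / (w + R) < 1 := by rw [div_lt_one hA]; linarith
  obtain ⟨θ₀, hθ0, hθ1, hcos⟩ :
      ∃ θ₀ : ℝ, 0 < θ₀ ∧ θ₀ < π / 2 ∧ cos θ₀ = √((2 * k ^ 2 - 1) / k ^ 2) := by
    have h1 : √(2 * w / (w + R)) < 1 := by rwa [sqrt_lt' one_pos, one_pow]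
    have h2 := sqrt_pos.2 hr0
    refine ⟨arccos √((2 * k ^ 2 - 1) / k ^ 2), ?_, ?_, cos_arccos ?_ ?_⟩ <;> rw [hratio]
    · exact arccos_pos.2 h1
    · exact arccos_lt_pi_div_two.2 h2
    · linarith
    · exact h1.le
  have hcos2 : cos θ₀ ^ 2 = 2 * w / (w + R) := by rw [hcos, hratio, sq_sqrt hr0.le]
  have hacos : a * cos θ₀ = √(2 * w) := by
    have hc : 0 < cos θ₀ := cos_pos_of_mem_Ioo ⟨by linarith [pi_pos], hθ1⟩
    rw [← sqrt_sq (mul_pos ha hc).le, mul_pow, hasq, hcos2]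
    congr 1
    field_simp
  have hsin2 : sin θ₀ ^ 2 = (R - w) / (w + R) := by
    rw [sin_sq, hcos2]; field_simp; ring
  have hslope : p ^ 2 = (a * b * (sin θ₀ * √(1 - k ^ 2 * sin θ₀ ^ 2))) ^ 2 := by
    rw [mul_pow, mul_pow, mul_pow, sq_sqrt (one_sub_mul_sin_sq_pos hk2 θ₀).le, hsin2, hasq, hbsq,
      hksq]
    field_simp
    linear_combination (-1 : ℝ) * hRsq
  obtain ⟨s, hs, hps⟩ : ∃ s : ℝ, (s = 1 ∨ s = -1) ∧
      p = -(a * b) * (sin (s * θ₀) * √(1 - k ^ 2 * sin (s * θ₀) ^ 2)) := by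
    rcases sq_eq_sq_iff_eq_or_eq_neg.1 hslope with h | h
    · exact ⟨-1, Or.inr rfl, by rw [h, neg_one_mul, sin_neg, neg_sq]; ring⟩
    · exact ⟨1, Or.inl rfl, by rw [h, one_mul]; ring⟩
  obtain ⟨am, ham, ham'⟩ := exists_jacobi_amplitude hk2
  have hodd : ellipticF k (s * θ₀) = s * ellipticF k θ₀ := by
    rcases hs with rfl | rfl
    · simp
    · rw [neg_one_mul, neg_one_mul, ellipticF_neg]
  set θ : ℝ → ℝ := fun x => am (b * x + s * ellipticF k θ₀) with hθdef
  have hθd : ∀ x, HasDerivAt θ (b * √(1 - k ^ 2 * sin (θ x) ^ 2)) x := by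
    intro x
    have hlin : HasDerivAt (fun x => b * x + s * ellipticF k θ₀) b x := by
      simpa using ((hasDerivAt_id x).const_mul b).add_const (s * ellipticF k θ₀)
    exact ((ham' _).comp x hlin).congr_deriv (mul_comm _ _)
  have hθ00 : θ 0 = s * θ₀ := by
    apply (strictMono_ellipticF hk2).injective
    rw [hθdef, ham, hodd]
    ring
  have hcoss : cos (s * θ₀) = cos θ₀ := by
    rcases hs with rfl | rfl <;> simp
  refine ⟨k, a, b, s, θ₀, θ, hk, hk1, hk2, ha, hb, hbw, hθ0, hθ1, hcos, hacos, hs,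
    fun x => ham _, ?_⟩
  exact duffing_unique hu hu' (hasDerivAt_cnoidal hθd)
    (hasDerivAt_deriv_cnoidal hk2 hbw hba hθd) (by rw [h0, hθ00, hcoss, hacos])
    (by rw [hθ00]; exact hps)

lemma ne_two_mul_int_of_irrational {α : ℝ} (hα : Irrational α) {n : ℕ} (hn : 0 < n) (m : ℤ) :
    2 * (α * n) ≠ m := by
  have h := (hα.mul_natCast hn.ne').natCast_mul (two_ne_zero)
  simpa using h.ne_int m

/-- any solution of (P₊)/(P₋) with irrational α = L₁/L comes from a
cnoidal function: there are n ≥ 1 and k ∈ (1/√2, 1) with S(k) = L√(−ω)/n, u is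
L/n-periodic, and φ(k) = ξ_n (case ε = +1) or φ(k) = 1 − ξ_n (case ε = −1). -/
theorem stmt_1 (L₁ L α : ℝ) (hL₁ : 0 < L₁) (hL : L₁ ≤ L / 2)
    (hα : α = L₁ / L) (hirr : Irrational α)
    (ω : ℝ) (hω : ω < 0) (u : ℝ → ℝ) (hu : ContDiff ℝ 2 u)
    (hper : Function.Periodic u L)
    (heq : ∀ x : ℝ, -(deriv (deriv u) x) - (u x)^3 = ω * u x)
    (ε : ℝ) (hε : ε = 1 ∨ ε = -1)
    (h0 : u 0 = Real.sqrt (2 * |ω|)) (hL1 : u L₁ = ε * Real.sqrt (2 * |ω|)) :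
    ∃ n : ℕ, 0 < n ∧ ∃ k ∈ Set.Ioo (1 / Real.sqrt 2) 1,
      Sfun k = L * Real.sqrt (-ω) / n ∧ Function.Periodic u (L / n) ∧
      (ε = 1 → phiFun k = xiSeq α n) ∧ (ε = -1 → phiFun k = 1 - xiSeq α n) := by
  have hLpos : 0 < L := by linarith
  have hw : 0 < -ω := by linarith
  rw [abs_of_neg hω] at h0 hL1
  have hu1 : ∀ x, HasDerivAt u (deriv u x) x := fun x =>
    ((hu.differentiable (by norm_num)) x).hasDerivAt
  have hu2 : ∀ x, HasDerivAt (deriv u) (-ω * u x - u x ^ 3) x := by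
    intro x
    have hd : ContDiff ℝ 1 (deriv u) := ((contDiff_succ_iff_deriv (n := 1)).1 hu).2.2
    refine ((hd.differentiable (by norm_num)) x).hasDerivAt.congr_deriv ?_
    linarith [heq x]
  obtain ⟨k, a, b, s, θ₀, θ, hk, hk1, hk2, ha, hb, hbw, hθ0, hθ1, hcos, hacos, hs, hθ, hrep⟩ :=
    exists_cnoidal_representation hw hu1 hu2 h0
      fun h => not_periodic_of_homoclinic hw hLpos hu1 hu2 h0 h hper
  have hK := ellipticF_pi_div_two_pos hk2
  have hH0 : 0 < ellipticF k θ₀ := by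
    simpa [ellipticF_zero] using strictMono_ellipticF hk2 hθ0
  have hH1 : ellipticF k θ₀ < ellipticF k (π / 2) := strictMono_ellipticF hk2 hθ1
  have hHfun : Hfun k = ellipticF k θ₀ := by
    rw [Hfun, ← hcos, integral_cos_substitution k hθ0.le (by linarith [pi_pos])]
  have hphi : phiFun k = ellipticF k θ₀ / ellipticF k (π / 2) := by
    rw [phiFun, hHfun, Kell_eq_ellipticF]
  have hsub : ellipticF k (π - θ₀) = 2 * ellipticF k (π / 2) - ellipticF k θ₀ := by
    rw [show π - θ₀ = -θ₀ + π by ring, ellipticF_add_pi hk2, ellipticF_neg]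
    ring
  have hinj := (strictMono_ellipticF hk2).injective
  have hF := ellipticF_int_mul_two_pi_add hk2
  set K := ellipticF k (π / 2)
  set H := ellipticF k θ₀
  have hquarter : ∀ x, u (x + 4 * K / b) = u x := by
    intro x
    have h : θ (x + 4 * K / b) = ((1 : ℤ) : ℝ) * (2 * π) + θ x := by
      apply hinj
      rw [hF, hθ, hθ]
      push_cast
      field_simp
      ring
    rw [hrep, hrep, h]
    simp [add_comm _ (θ x)]
  obtain ⟨n, hn, hbL⟩ : ∃ n : ℕ, 0 < n ∧ b * L = n * (4 * K) := by
    have hpeak : θ (-(s * H) / b) = 0 := by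
      apply hinj
      rw [hθ, ellipticF_zero]
      field_simp
      ring
    have h := hper (-(s * H) / b)
    rw [hrep, hrep, hpeak, cos_zero] at h
    obtain ⟨m, hm⟩ := (cos_eq_one_iff _).1 (mul_left_cancel₀ ha.ne' h)
    have h2 := hF m 0
    rw [add_zero, hm, hθ, ellipticF_zero] at h2
    have h3 : b * L = m * (4 * K) := by
      rw [← add_zero ((m : ℝ) * (4 * K)), ← h2]
      field_simp
      ring
    have hm0 : 0 < m := by
      by_contra! hneg
      have : (m : ℝ) ≤ 0 := by exact_mod_cast hneg
      nlinarith [mul_pos hb hLpos]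
    lift m to ℕ using hm0.le
    exact ⟨m, by exact_mod_cast hm0, by exact_mod_cast h3⟩
  have hn' : (0 : ℝ) < n := by exact_mod_cast hn
  have hbL1 : b * L₁ = 4 * K * (α * n) := by
    rw [hα]
    field_simp
    linear_combination hbL
  have hirr' := ne_two_mul_int_of_irrational hirr hn
  refine ⟨n, hn, k, ⟨?_, ?_⟩, ?_, ?_, ?_, ?_⟩
  · rw [div_lt_iff₀ (by positivity), ← sqrt_sq hk.le, ← sqrt_mul (sq_nonneg k)]
    exact (lt_sqrt zero_le_one).2 (by linarith)
  · exact (sq_lt_one_iff₀ hk.le).1 hk2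
  · rw [Sfun, Kell_eq_ellipticF, ← hbw, sqrt_mul (sq_nonneg b), sqrt_sq hb.le, eq_div_iff hn'.ne']
    linear_combination (-√(2 * k ^ 2 - 1)) * hbL
  · have h : L / n = 4 * K / b := by
      field_simp
      linear_combination hbL
    rw [h]
    exact hquarter
  · rintro rfl
    rw [hrep, one_mul, ← hacos] at hL1
    obtain ⟨m, hm⟩ := cos_eq_cos_iff.1 (mul_left_cancel₀ ha.ne' hL1).symm
    have hm' : b * L₁ + s * H = m * (4 * K) + H ∨ b * L₁ + s * H = m * (4 * K) - H := by
      rw [← hθ]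
      refine hm.imp (fun h => ?_) fun h => ?_
      · rw [h, show 2 * (m : ℝ) * π + θ₀ = m * (2 * π) + θ₀ by ring, hF]
      · rw [h, show 2 * (m : ℝ) * π - θ₀ = m * (2 * π) + -θ₀ by ring, hF, ellipticF_neg]
        ring
    rw [hbL1] at hm'
    rw [hphi]
    refine (xiSeq_eq (m := m) (by positivity) ((div_lt_one hK).2 hH1) ?_).symm
    have hrat : 4 * K * (α * n) ≠ m * (4 * K) := by
      intro h
      apply hirr' (2 * m)
      have : α * n = m := mul_left_cancel₀ (by positivity : 4 * K ≠ 0) (h.trans (mul_comm _ _))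
      rw [this]; push_cast; ring
    rcases hs with rfl | rfl <;> rcases hm' with h | h
    · exact absurd (by linarith) hrat
    · right; field_simp; linarith
    · left; field_simp; linarith
    · exact absurd (by linarith) hrat
  · rintro rfl
    rw [hrep, neg_one_mul, ← hacos, ← mul_neg, ← cos_pi_sub] at hL1
    obtain ⟨m, hm⟩ := cos_eq_cos_iff.1 (mul_left_cancel₀ ha.ne' hL1).symm
    have hm' : b * L₁ + s * H = m * (4 * K) + (2 * K - H) ∨
        b * L₁ + s * H = m * (4 * K) - (2 * K - H) := by
      rw [← hθ]
      refine hm.imp (fun h => ?_) fun h => ?_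
      · rw [h, show 2 * (m : ℝ) * π + (π - θ₀) = m * (2 * π) + (π - θ₀) by ring, hF, hsub]
      · rw [h, show 2 * (m : ℝ) * π - (π - θ₀) = m * (2 * π) + -(π - θ₀) by ring, hF,
          ellipticF_neg, hsub]
        ring
    rw [hbL1] at hm'
    have hHK : H / K < 1 := (div_lt_one hK).2 hH1
    rw [hphi, xiSeq_eq (φ := 1 - H / K) (m := m) (by linarith) (by linarith [div_pos hH0 hK]) ?_]
    · ring
    have hrat : ∀ j : ℤ, 4 * K * (α * n) ≠ j * (2 * K) := by
      intro j h
      apply hirr' j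
      apply mul_left_cancel₀ (by positivity : 2 * K ≠ 0)
      linarith
    rcases hs with rfl | rfl <;> rcases hm' with h | h
    · left; field_simp; linarith
    · exact absurd (by push_cast; linarith) (hrat (2 * m - 1))
    · exact absurd (by push_cast; linarith) (hrat (2 * m + 1))
    · right; field_simp; linarith
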